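/- arXiv:1601.02318 — 5 statements merged into one kernel-verified Lean document; each statement's English description precedes it below -/
import Mathlib

section
/- Under Parodi's relation α₆ − α₅ = α₂ + α₃ the following algebraic identity holds: for every unit vector n ∈ ℝ³, every 3×3 real matrix A and every vector ṅ ∈ ℝ³, T·A + g·ṅ = α₁ (Dn·n)² + 2γ₂ (m·Dn) + α₄ |D|_F² + (α₅+α₆) |Dn|² + γ₁ |m|², where |X|_F² = X·X is the squared Frobenius norm. (This is the statement that the viscous dissipation g^v·ṅ + T^v·∇v equals the quadratic form 2R_LC of equation (2.25) of the paper.) -/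
open Matrix

/-- Under Parodi's relation, the viscous dissipation `T·∇v + g·ṅ` equals the
quadratic form `2 R_LC` of equation (2.25). -/
theorem leslie_dissipation_identity
    (α1 α2 α3 α4 α5 α6 : ℝ) (hParodi : α6 - α5 = α2 + α3)
    (n : Fin 3 → ℝ) (hn : n ⬝ᵥ n = 1)
    (A : Matrix (Fin 3) (Fin 3) ℝ) (ndot : Fin 3 → ℝ) :
    let D : Matrix (Fin 3) (Fin 3) ℝ := (1/2 : ℝ) • (A + Aᵀ)
    let W : Matrix (Fin 3) (Fin 3) ℝ := (1/2 : ℝ) • (A - Aᵀ)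
    let m : Fin 3 → ℝ := ndot - W.mulVec n
    let γ1 : ℝ := α3 - α2
    let γ2 : ℝ := α6 - α5
    let T : Matrix (Fin 3) (Fin 3) ℝ :=
      (α1 * (D.mulVec n ⬝ᵥ n)) • vecMulVec n n + α2 • vecMulVec m n
        + α3 • vecMulVec n m + α4 • D + α5 • vecMulVec (D.mulVec n) n
        + α6 • vecMulVec n (D.mulVec n)
    let g : Fin 3 → ℝ := γ1 • m + γ2 • D.mulVec n
    (Aᵀ * T).trace + g ⬝ᵥ ndot
      = α1 * (D.mulVec n ⬝ᵥ n)^2 + 2 * γ2 * (m ⬝ᵥ D.mulVec n)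
        + α4 * (Dᵀ * D).trace + (α5 + α6) * (D.mulVec n ⬝ᵥ D.mulVec n)
        + γ1 * (m ⬝ᵥ m) := by
  intro D W m γ1 γ2 T g
  have hA : A = D + W := by
    ext i j; simp [D, W]; ring
  have hD : Dᵀ = D := by
    ext i j; simp [D]; ring
  have hW : Wᵀ = -W := by
    ext i j; simp [W]; ring
  have hnd : ndot = m + W.mulVec n := by simp [m]
  have h6 : α6 = α5 + (α2 + α3) := by linarith
  have key : ∀ a b : Fin 3 → ℝ, (Aᵀ * vecMulVec a b).trace
      = a ⬝ᵥ D.mulVec b + a ⬝ᵥ W.mulVec b := by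
    intro a b
    rw [mul_vecMulVec, trace_vecMulVec, ← dotProduct_add, ← add_mulVec, ← hA,
      mulVec_transpose, dotProduct_mulVec]
  have sD : ∀ a b : Fin 3 → ℝ, a ⬝ᵥ D.mulVec b = D.mulVec a ⬝ᵥ b := by
    intro a b
    rw [dotProduct_mulVec, ← mulVec_transpose, hD]
  have sW : ∀ a b : Fin 3 → ℝ, a ⬝ᵥ W.mulVec b = -(W.mulVec a ⬝ᵥ b) := by
    intro a b
    rw [dotProduct_mulVec, ← mulVec_transpose, hW, neg_mulVec, neg_dotProduct]
  have tD : (Aᵀ * D).trace = (Dᵀ * D).trace := by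
    have h : (Wᵀ * D).trace = 0 := by
      have h1 : (Wᵀ * D).trace = (W * D).trace := by
        rw [← trace_transpose, transpose_mul, transpose_transpose, hD, trace_mul_comm]
      have h2 : (Wᵀ * D).trace = -(W * D).trace := by
        rw [hW, neg_mul, trace_neg]
      linarith
    rw [hA, transpose_add, add_mul, trace_add, h, add_zero]
  have hnn : n ⬝ᵥ W.mulVec n = 0 := by
    have := sW n n
    rw [dotProduct_comm (W.mulVec n) n] at this
    linarith
  have hT : (Aᵀ * T).trace = α1 * (D.mulVec n ⬝ᵥ n) * (D.mulVec n ⬝ᵥ n)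
      + α2 * (m ⬝ᵥ D.mulVec n + m ⬝ᵥ W.mulVec n)
      + α3 * (m ⬝ᵥ D.mulVec n - m ⬝ᵥ W.mulVec n) + α4 * (Dᵀ * D).trace
      + α5 * (D.mulVec n ⬝ᵥ D.mulVec n + D.mulVec n ⬝ᵥ W.mulVec n)
      + α6 * (D.mulVec n ⬝ᵥ D.mulVec n - D.mulVec n ⬝ᵥ W.mulVec n) := by
    simp only [T, mul_add, mul_smul_comm, Matrix.mul_smul, trace_add, trace_smul, key, smul_eq_mul, tD]
    rw [hnn, sD n n, sD n m, sW n m, sD n (D.mulVec n), sW n (D.mulVec n),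
      dotProduct_comm (D.mulVec n) m, dotProduct_comm (W.mulVec n) m,
      dotProduct_comm (W.mulVec n) (D.mulVec n)]
    ring
  have hg : g ⬝ᵥ ndot = γ1 * (m ⬝ᵥ m + m ⬝ᵥ W.mulVec n)
      + γ2 * (m ⬝ᵥ D.mulVec n + D.mulVec n ⬝ᵥ W.mulVec n) := by
    rw [hnd]
    simp only [g, add_dotProduct, smul_dotProduct, dotProduct_add, smul_eq_mul]
    rw [dotProduct_comm (D.mulVec n) m]
    ring
  rw [hT, hg]
  simp only [γ1, γ2]
  rw [h6]
  ring
end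

section
/- (Ericksen's sufficient conditions for nonnegative dissipation.) Let n ∈ ℝ³ with |n| = 1, let D be a symmetric 3×3 real matrix with tr D = 0, and let m ∈ ℝ³ with m·n = 0. If the Leslie coefficients satisfy α₄ > 0, α₁ + (3/2)α₄ + α₅ + α₆ > 0, γ₁ > 0, and γ₁(2α₄ + α₅ + α₆) ≥ γ₂², then α₁ (Dn·n)² + 2γ₂ (m·Dn) + α₄ |D|_F² + (α₅+α₆) |Dn|² + γ₁ |m|² ≥ 0. -/
open Matrix

lemma ericksen_aux (a b c d e f x y z u v w s : ℝ) (hN : x*x+y*y+z*z = 1)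
    (ht : a + d + f = 0) (hu : u = a*x+b*y+c*z) (hv : v = b*x+d*y+e*z)
    (hw : w = c*x+e*y+f*z) (hs : s = u*x+v*y+w*z) :
    0 ≤ a^2+d^2+f^2+2*(b^2+c^2+e^2) - 2*(u^2+v^2+w^2) + s^2/2 := by
  have key : a^2+d^2+f^2+2*(b^2+c^2+e^2) - 2*(u^2+v^2+w^2) + s^2/2
      = (a - 2*u*x + s/2*x^2 + s/2)^2 + (d - 2*v*y + s/2*y^2 + s/2)^2
        + (f - 2*w*z + s/2*z^2 + s/2)^2
        + 2*((b - u*y - x*v + s/2*x*y)^2 + (c - u*z - x*w + s/2*x*z)^2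
          + (e - v*z - y*w + s/2*y*z)^2) := by
    linear_combination (-(2*(u^2+v^2+w^2) + s^2/4*(x*x+y*y+z*z+1) - 2*s^2 + s^2/2)) * hN
      - s * ht - 4*u*hu - 4*v*hv - 4*w*hw + s*x*hu + s*y*hv + s*z*hw
      + (2*s*(x*x+y*y+z*z) + 2*(u*x+v*y+w*z) - 3*s + 4*s - 4*s*(x*x+y*y+z*z)) * hs
  rw [key]; positivity

/-- Ericksen's sufficient conditions for nonnegativity of the Leslie–Ericksen
viscous dissipation `2 R_LC`. -/
theorem ericksen_dissipation_nonneg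
    (α1 α4 α5 α6 γ1 γ2 : ℝ)
    (n : Fin 3 → ℝ) (hn : n ⬝ᵥ n = 1)
    (D : Matrix (Fin 3) (Fin 3) ℝ) (hD : D.IsSymm) (htr : D.trace = 0)
    (m : Fin 3 → ℝ) (hmn : m ⬝ᵥ n = 0)
    (h1 : 0 < α4)
    (h2 : 0 < α1 + (3/2) * α4 + α5 + α6)
    (h3 : 0 < γ1)
    (h4 : γ2^2 ≤ γ1 * (2 * α4 + α5 + α6)) :
    0 ≤ α1 * (D.mulVec n ⬝ᵥ n)^2 + 2 * γ2 * (m ⬝ᵥ D.mulVec n)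
      + α4 * (Dᵀ * D).trace + (α5 + α6) * (D.mulVec n ⬝ᵥ D.mulVec n)
      + γ1 * (m ⬝ᵥ m) := by
  have e10 : D 1 0 = D 0 1 := hD.apply 0 1
  have e20 : D 2 0 = D 0 2 := hD.apply 0 2
  have e21 : D 2 1 = D 1 2 := hD.apply 1 2
  simp only [Matrix.trace, Matrix.diag, Matrix.mul_apply, Matrix.transpose_apply, Matrix.mulVec,
    dotProduct, Fin.sum_univ_three, e10, e20, e21] at *
  generalize D 0 0 = a at *
  generalize D 0 1 = b at *
  generalize D 0 2 = c at *
  generalize D 1 1 = d at *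
  generalize D 1 2 = e at *
  generalize D 2 2 = f at *
  generalize n 0 = x at *
  generalize n 1 = y at *
  generalize n 2 = z at *
  generalize m 0 = p at *
  generalize m 1 = q at *
  generalize m 2 = r at *
  generalize hu : a*x+b*y+c*z = u
  generalize hv : b*x+d*y+e*z = v
  generalize hw : c*x+e*y+f*z = w
  generalize hs : u*x+v*y+w*z = s
  have k := ericksen_aux a b c d e f x y z u v w s hn htr hu.symm hv.symm hw.symm hs.symm
  have k1 := mul_nonneg h1.le k
  have k2 := mul_nonneg h2.le (sq_nonneg s)
  have k3 : 0 ≤ (2*α4+α5+α6)*((u-s*x)^2+(v-s*y)^2+(w-s*z)^2)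
      + 2*γ2*(p*(u-s*x)+q*(v-s*y)+r*(w-s*z)) + γ1*(p*p+q*q+r*r) := by
    refine nonneg_of_mul_nonneg_right (a := γ1) ?_ h3
    have : 0 ≤ (γ1*(2*α4+α5+α6) - γ2^2)*((u-s*x)^2+(v-s*y)^2+(w-s*z)^2) :=
      mul_nonneg (by linarith) (by positivity)
    linarith [sq_nonneg (γ1*p+γ2*(u-s*x)), sq_nonneg (γ1*q+γ2*(v-s*y)),
      sq_nonneg (γ1*r+γ2*(w-s*z))]
  have k4 : (u-s*x)^2+(v-s*y)^2+(w-s*z)^2 = u^2+v^2+w^2 - s^2 := by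
    linear_combination s^2*hn - 2*s*hs
  have k5 : p*(u-s*x)+q*(v-s*y)+r*(w-s*z) = p*u+q*v+r*w := by
    linear_combination -s*hmn
  rw [k4, k5] at k3
  linarith
end

section
/- (Characterization of zero dissipation.) Let n ∈ ℝ³ with |n| = 1, let D be a symmetric 3×3 real matrix with tr D = 0, and let m ∈ ℝ³ with m·n = 0. If α₄ > 0, α₁ + (3/2)α₄ + α₅ + α₆ > 0, γ₁ > 0, and γ₁(2α₄ + α₅ + α₆) > γ₂² (strict inequality), then α₁ (Dn·n)² + 2γ₂ (m·Dn) + α₄ |D|_F² + (α₅+α₆) |Dn|² + γ₁ |m|² = 0 if and only if D = 0 and m = 0. -/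
open Matrix

lemma aux_norm (d11 d12 d13 d22 d23 d33 x y z u v w a : ℝ)
    (hn : x*x+y*y+z*z = 1) (ht : d11+d22+d33 = 0)
    (hu : u = d11*x+d12*y+d13*z) (hv : v = d12*x+d22*y+d23*z) (hw : w = d13*x+d23*y+d33*z)
    (ha : a = u*x+v*y+w*z) :
    d11^2+d22^2+d33^2+2*(d12^2+d13^2+d23^2) = 2*(u^2+v^2+w^2) - a^2/2
     + ((d11-(2*u*x-a/2*x*x-a/2))^2 + (d22-(2*v*y-a/2*y*y-a/2))^2 + (d33-(2*w*z-a/2*z*z-a/2))^2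
      + 2*((d12-(u*y+v*x-a/2*x*y))^2 + (d13-(u*z+w*x-a/2*x*z))^2 + (d23-(v*z+w*y-a/2*y*z))^2)) := by
  have hF : (2*u*x-a/2*x*x-a/2)^2 + (2*v*y-a/2*y*y-a/2)^2 + (2*w*z-a/2*z*z-a/2)^2
      + 2*((u*y+v*x-a/2*x*y)^2 + (u*z+w*x-a/2*x*z)^2 + (v*z+w*y-a/2*y*z)^2)
      = 2*(u^2+v^2+w^2) - a^2/2 := by
    have e : (2*u*x-a/2*x*x-a/2)^2 + (2*v*y-a/2*y*y-a/2)^2 + (2*w*z-a/2*z*z-a/2)^2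
      + 2*((u*y+v*x-a/2*x*y)^2 + (u*z+w*x-a/2*x*z)^2 + (v*z+w*y-a/2*y*z)^2)
      = 2*(u^2+v^2+w^2)*(x*x+y*y+z*z) + 2*(u*x+v*y+w*z)^2 + a^2/4*(x*x+y*y+z*z)^2 + 3*a^2/4
        - 2*a*(u*x+v*y+w*z)*(x*x+y*y+z*z) - 2*a*(u*x+v*y+w*z) + a^2/2*(x*x+y*y+z*z) := by ring
    rw [e, hn, ← ha]; ring
  have hDF : d11*(2*u*x-a/2*x*x-a/2) + d22*(2*v*y-a/2*y*y-a/2) + d33*(2*w*z-a/2*z*z-a/2)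
      + 2*(d12*(u*y+v*x-a/2*x*y) + d13*(u*z+w*x-a/2*x*z) + d23*(v*z+w*y-a/2*y*z))
      = 2*(u^2+v^2+w^2) - a^2/2 := by
    linear_combination (-a/2)*ht - 2*u*hu - 2*v*hv - 2*w*hw + a/2*ha + (a/2)*(x*hu+y*hv+z*hw)
  linear_combination 2*hDF - hF

lemma aux_zero {a b c d : ℝ} (ha : 0 ≤ a) (hb : 0 ≤ b) (hc : 0 ≤ c) (hd : 0 ≤ d)
    (h : a + b + c + d = 0) : a = 0 ∧ b = 0 ∧ c = 0 ∧ d = 0 := by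
  refine ⟨?_, ?_, ?_, ?_⟩ <;> linarith

lemma aux_sq {a b c : ℝ} (h : a^2+b^2+c^2 = 0) : a = 0 ∧ b = 0 ∧ c = 0 := by
  refine ⟨?_, ?_, ?_⟩ <;> nlinarith [sq_nonneg a, sq_nonneg b, sq_nonneg c]

set_option maxHeartbeats 1000000 in
lemma aux_main (α1 α4 β γ1 γ2 d11 d12 d13 d22 d23 d33 x y z u v w a p q r : ℝ)
    (hn : x*x+y*y+z*z = 1) (ht : d11+d22+d33 = 0)
    (hu : u = d11*x+d12*y+d13*z) (hv : v = d12*x+d22*y+d23*z) (hw : w = d13*x+d23*y+d33*z)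
    (ha : a = u*x+v*y+w*z) (hm : p*x+q*y+r*z = 0)
    (h1 : 0 < α4) (h2 : 0 < α1 + (3/2) * α4 + β) (h3 : 0 < γ1)
    (h4 : γ2^2 < γ1 * (2 * α4 + β))
    (h : α1*a^2 + 2*γ2*(p*u+q*v+r*w) + α4*(d11^2+d22^2+d33^2+2*(d12^2+d13^2+d23^2))
      + β*(u^2+v^2+w^2) + γ1*(p^2+q^2+r^2) = 0) :
    (d11 = 0 ∧ d12 = 0 ∧ d13 = 0 ∧ d22 = 0 ∧ d23 = 0 ∧ d33 = 0) ∧ p = 0 ∧ q = 0 ∧ r = 0 := by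
  have hN := aux_norm d11 d12 d13 d22 d23 d33 x y z u v w a hn ht hu hv hw ha
  obtain ⟨E, hE⟩ : ∃ E, E = ((d11-(2*u*x-a/2*x*x-a/2))^2 + (d22-(2*v*y-a/2*y*y-a/2))^2
      + (d33-(2*w*z-a/2*z*z-a/2))^2
      + 2*((d12-(u*y+v*x-a/2*x*y))^2 + (d13-(u*z+w*x-a/2*x*z))^2 + (d23-(v*z+w*y-a/2*y*z))^2)) :=
    ⟨_, rfl⟩
  rw [← hE] at hN
  have hE0 : 0 ≤ E := by rw [hE]; positivity
  have hW : (u-a*x)^2+(v-a*y)^2+(w-a*z)^2 = u^2+v^2+w^2 - a^2 := by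
    linear_combination a^2*hn + 2*a*ha
  have hmw : p*(u-a*x)+q*(v-a*y)+r*(w-a*z) = p*u+q*v+r*w := by
    linear_combination -a*hm
  have key : γ1*(α1 + (3/2) * α4 + β)*a^2
      + (γ1 * (2 * α4 + β) - γ2^2)*((u-a*x)^2+(v-a*y)^2+(w-a*z)^2)
      + ((γ1*p+γ2*(u-a*x))^2 + (γ1*q+γ2*(v-a*y))^2 + (γ1*r+γ2*(w-a*z))^2)
      + γ1*α4*E = 0 := by
    linear_combination γ1*h - γ1*α4*hN + γ1*(2*α4+β)*hW + 2*γ1*γ2*hmw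
  have h5 : 0 < γ1 * (2 * α4 + β) - γ2^2 := by linarith
  obtain ⟨k1, k2, k3, k4⟩ := aux_zero (by positivity) (by positivity) (by positivity)
    (by positivity) key
  have a0 : a = 0 := by
    have : γ1*(α1 + (3/2) * α4 + β) ≠ 0 := by positivity
    simpa [this] using k1
  obtain ⟨w1, w2, w3⟩ := aux_sq ((mul_eq_zero.mp k2).resolve_left h5.ne')
  have e0 : E = 0 := (mul_eq_zero.mp k4).resolve_left (by positivity)
  obtain ⟨m1, m2, m3⟩ := aux_sq k3
  rw [w1] at m1
  rw [w2] at m2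
  rw [w3] at m3
  have u0 : u = 0 := by rw [a0] at w1; linarith
  have v0 : v = 0 := by rw [a0] at w2; linarith
  have w0 : w = 0 := by rw [a0] at w3; linarith
  rw [e0, u0, v0, w0, a0] at hN
  have hg := h3.ne'
  refine ⟨⟨?_, ?_, ?_, ?_, ?_, ?_⟩, by simpa [hg] using m1, by simpa [hg] using m2,
    by simpa [hg] using m3⟩ <;>
  refine pow_eq_zero_iff (two_ne_zero) |>.mp ?_ <;>
  linarith [sq_nonneg d11, sq_nonneg d12, sq_nonneg d13, sq_nonneg d22, sq_nonneg d23,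
    sq_nonneg d33]

/-- Characterization of zero dissipation: under Ericksen's conditions with the
strict inequality, the dissipation vanishes iff `D = 0` and `m = 0`. -/
theorem ericksen_dissipation_eq_zero_iff
    (α1 α4 α5 α6 γ1 γ2 : ℝ)
    (n : Fin 3 → ℝ) (hn : n ⬝ᵥ n = 1)
    (D : Matrix (Fin 3) (Fin 3) ℝ) (hD : D.IsSymm) (htr : D.trace = 0)
    (m : Fin 3 → ℝ) (hmn : m ⬝ᵥ n = 0)
    (h1 : 0 < α4)
    (h2 : 0 < α1 + (3/2) * α4 + α5 + α6)
    (h3 : 0 < γ1)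
    (h4 : γ2^2 < γ1 * (2 * α4 + α5 + α6)) :
    α1 * (D.mulVec n ⬝ᵥ n)^2 + 2 * γ2 * (m ⬝ᵥ D.mulVec n)
      + α4 * (Dᵀ * D).trace + (α5 + α6) * (D.mulVec n ⬝ᵥ D.mulVec n)
      + γ1 * (m ⬝ᵥ m) = 0 ↔ D = 0 ∧ m = 0 := by
  constructor
  · intro h
    have s1 := hD.apply 0 1
    have s2 := hD.apply 0 2
    have s3 := hD.apply 1 2
    simp only [dotProduct, mulVec, Matrix.trace, Matrix.diag, Matrix.mul_apply,
      Matrix.transpose_apply, Fin.sum_univ_three] at hn htr hmn h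
    rw [s1, s2, s3] at h
    obtain ⟨⟨e1, e2, e3, e4, e5, e6⟩, f1, f2, f3⟩ := aux_main α1 α4 (α5+α6) γ1 γ2
      (D 0 0) (D 0 1) (D 0 2) (D 1 1) (D 1 2) (D 2 2) (n 0) (n 1) (n 2) _ _ _ _ (m 0) (m 1) (m 2)
      hn htr rfl rfl rfl rfl hmn h1 (by linarith) h3 (by linarith) (by linear_combination h)
    refine ⟨?_, ?_⟩
    · ext i j
      fin_cases i <;> fin_cases j <;> simp_all
    · ext i
      fin_cases i <;> simp_all
  · rintro ⟨rfl, rfl⟩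
    simp
end

section
/- (The Leslie stress is the gradient of the dissipation with respect to the velocity gradient.) Assume Parodi's relation α₆ − α₅ = α₂ + α₃. Fix a unit vector n ∈ ℝ³ and a vector ṅ ∈ ℝ³, and define R : M₃(ℝ) → ℝ by R(A) = (1/2)[α₁ (Dn·n)² + 2γ₂ (m·Dn) + α₄ |D|_F² + (α₅+α₆)|Dn|² + γ₁ |m|²], where D = (A+Aᵀ)/2, W = (A−Aᵀ)/2 and m = ṅ − W n. Then R is differentiable and for every 3×3 matrix B its Fréchet derivative at A in direction B equals T·B = tr(Bᵀ T), where T = α₁ (Dn·n) n⊗n + α₂ m⊗n + α₃ n⊗m + α₄ D + α₅ (Dn)⊗n + α₆ n⊗(Dn) is the Leslie viscous stress built from D, W, m at A. -/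
open Matrix

attribute [local instance] Matrix.normedAddCommGroup Matrix.normedSpace

/-- The Leslie viscous stress is the gradient of the dissipation function with
respect to the velocity gradient: under Parodi's relation, `R` is differentiable
in `A` and its Fréchet derivative at `A` in direction `B` is `T·B = tr(Bᵀ T)`. -/
theorem leslie_stress_is_gradient_of_dissipation
    (α1 α2 α3 α4 α5 α6 : ℝ) (hParodi : α6 - α5 = α2 + α3)
    (n : Fin 3 → ℝ) (hn : n ⬝ᵥ n = 1) (ndot : Fin 3 → ℝ)
    (R : Matrix (Fin 3) (Fin 3) ℝ → ℝ)
    (γ1 γ2 : ℝ) (hγ1 : γ1 = α3 - α2) (hγ2 : γ2 = α6 - α5)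
    (hR : ∀ A : Matrix (Fin 3) (Fin 3) ℝ,
      R A = (1/2) * (α1 * ((((1/2 : ℝ) • (A + Aᵀ)).mulVec n) ⬝ᵥ n)^2
        + 2 * γ2 * ((ndot - ((1/2 : ℝ) • (A - Aᵀ)).mulVec n) ⬝ᵥ ((1/2 : ℝ) • (A + Aᵀ)).mulVec n)
        + α4 * ((((1/2 : ℝ) • (A + Aᵀ))ᵀ * ((1/2 : ℝ) • (A + Aᵀ))).trace)
        + (α5 + α6) * ((((1/2 : ℝ) • (A + Aᵀ)).mulVec n) ⬝ᵥ (((1/2 : ℝ) • (A + Aᵀ)).mulVec n))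
        + γ1 * ((ndot - ((1/2 : ℝ) • (A - Aᵀ)).mulVec n) ⬝ᵥ (ndot - ((1/2 : ℝ) • (A - Aᵀ)).mulVec n))))
    (A : Matrix (Fin 3) (Fin 3) ℝ) :
    let D : Matrix (Fin 3) (Fin 3) ℝ := (1/2 : ℝ) • (A + Aᵀ)
    let W : Matrix (Fin 3) (Fin 3) ℝ := (1/2 : ℝ) • (A - Aᵀ)
    let m : Fin 3 → ℝ := ndot - W.mulVec n
    let T : Matrix (Fin 3) (Fin 3) ℝ :=
      (α1 * (D.mulVec n ⬝ᵥ n)) • vecMulVec n n + α2 • vecMulVec m n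
        + α3 • vecMulVec n m + α4 • D + α5 • vecMulVec (D.mulVec n) n
        + α6 • vecMulVec n (D.mulVec n)
    DifferentiableAt ℝ R A ∧
      ∀ B : Matrix (Fin 3) (Fin 3) ℝ, fderiv ℝ R A B = (Bᵀ * T).trace := by
  intro D W m T
  have hd : DifferentiableAt ℝ R A := by
    have hR' : R = _ := funext hR
    have he : ∀ i j : Fin 3, DifferentiableAt ℝ (fun X : Matrix (Fin 3) (Fin 3) ℝ => X i j) A := by
      intro i j
      exact differentiableAt_pi.1 (differentiableAt_pi.1 (differentiableAt_id (𝕜 := ℝ) (x := A)) i) j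
    rw [hR']
    simp only [Matrix.trace, Matrix.diag, Matrix.mul_apply, dotProduct, Matrix.mulVec,
      Fin.sum_univ_three, Matrix.smul_apply, Matrix.add_apply, Matrix.sub_apply,
      Matrix.transpose_apply, Pi.sub_apply, smul_eq_mul]
    fun_prop (disch := assumption)
  refine ⟨hd, fun B => ?_⟩
  set E : Matrix (Fin 3) (Fin 3) ℝ := (1/2 : ℝ) • (B + Bᵀ) with hE
  set V : Matrix (Fin 3) (Fin 3) ℝ := (1/2 : ℝ) • (B - Bᵀ) with hV
  have hB : B = E + V := by
    rw [hE, hV]; module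
  have hEt : Eᵀ = E := by
    rw [hE]; simp [add_comm]
  have hVt : Vᵀ = -V := by
    rw [hV]; simp [← smul_neg]
  have hDt : Dᵀ = D := by
    simp [D, add_comm]
  have htr : (E * D).trace = (D * E).trace := Matrix.trace_mul_comm _ _
  have htr0 : (V * D).trace = 0 := by
    have h1 : (V * D).trace = ((V * D)ᵀ).trace := (Matrix.trace_transpose _).symm
    rw [Matrix.transpose_mul, hDt, hVt, Matrix.mul_neg, Matrix.trace_neg,
      Matrix.trace_mul_comm D V] at h1
    linarith
  have hDD : ∀ t : ℝ, (1/2 : ℝ) • ((A + t • B) + (A + t • B)ᵀ) = D + t • E := by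
    intro t; simp only [D, E, Matrix.transpose_add, Matrix.transpose_smul]; module
  have hWW : ∀ t : ℝ, (1/2 : ℝ) • ((A + t • B) - (A + t • B)ᵀ) = W + t • V := by
    intro t; simp only [W, V, Matrix.transpose_add, Matrix.transpose_smul]; module
  set d := D.mulVec n with hdd
  set e := E.mulVec n with hee
  set v := V.mulVec n with hvv
  have hline : ∀ t : ℝ, R (A + t • B) =
      (1/2) * (α1 * (d ⬝ᵥ n + t * (e ⬝ᵥ n))^2
        + 2 * γ2 * (m ⬝ᵥ d + t * (m ⬝ᵥ e - v ⬝ᵥ d) - t^2 * (v ⬝ᵥ e))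
        + α4 * ((D * D).trace + t * (2 * (D * E).trace) + t^2 * (E * E).trace)
        + (α5 + α6) * (d ⬝ᵥ d + t * (2 * (d ⬝ᵥ e)) + t^2 * (e ⬝ᵥ e))
        + γ1 * (m ⬝ᵥ m - t * (2 * (m ⬝ᵥ v)) + t^2 * (v ⬝ᵥ v))) := by
    intro t
    have hm : ndot - (W + t • V).mulVec n = m - t • v := by
      simp only [Matrix.add_mulVec, Matrix.smul_mulVec, m, v]; abel
    have hdn : (D + t • E).mulVec n = d + t • e := by
      simp only [Matrix.add_mulVec, Matrix.smul_mulVec, d, e]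
    rw [hR, hDD, hWW, hm, hdn, Matrix.transpose_add D, Matrix.transpose_smul t E, hDt, hEt]
    simp only [add_dotProduct, dotProduct_add, sub_dotProduct, dotProduct_sub, smul_dotProduct,
      dotProduct_smul, smul_eq_mul, Matrix.add_mul, Matrix.mul_add, Matrix.smul_mul,
      Matrix.mul_smul, Matrix.trace_add, Matrix.trace_smul, htr]
    rw [dotProduct_comm e d, dotProduct_comm v m]
    ring
  have h1 : HasDerivAt (fun t : ℝ => R (A + t • B)) (fderiv ℝ R A B) 0 := by
    have := hd.hasFDerivAt.hasLineDerivAt B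
    exact this
  have h2 : HasDerivAt (fun t : ℝ => R (A + t • B))
      (α1 * (d ⬝ᵥ n) * (e ⬝ᵥ n) + γ2 * (m ⬝ᵥ e - v ⬝ᵥ d) + α4 * (D * E).trace
        + (α5 + α6) * (d ⬝ᵥ e) - γ1 * (m ⬝ᵥ v)) 0 := by
    rw [funext hline]
    have key : ∀ a b c : ℝ, HasDerivAt (fun t : ℝ => a + b * t + c * t^2) b 0 := by
      intro a b c
      have := (((hasDerivAt_id (0:ℝ)).const_mul b).const_add a).add
        (((hasDerivAt_id (0:ℝ)).pow 2).const_mul c)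
      simp only [id, mul_one] at this
      refine (this.congr_deriv ?_)
      simp
    convert key ((1/2) * (α1 * (d ⬝ᵥ n)^2 + 2 * γ2 * (m ⬝ᵥ d) + α4 * (D * D).trace
        + (α5 + α6) * (d ⬝ᵥ d) + γ1 * (m ⬝ᵥ m))) _
      ((1/2) * (α1 * (e ⬝ᵥ n)^2 - 2 * γ2 * (v ⬝ᵥ e) + α4 * (E * E).trace
        + (α5 + α6) * (e ⬝ᵥ e) + γ1 * (v ⬝ᵥ v))) using 1
    funext t
    ring
  rw [h1.unique h2]
  have hmv : ∀ x y : Fin 3 → ℝ, ∀ M : Matrix (Fin 3) (Fin 3) ℝ,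
      (M * vecMulVec x y).trace = (M.mulVec x) ⬝ᵥ y := by
    intro x y M
    rw [Matrix.mul_vecMulVec, Matrix.trace_vecMulVec]
  have hEs : ∀ x : Fin 3 → ℝ, E.mulVec x ⬝ᵥ n = x ⬝ᵥ e := by
    intro x
    rw [hee, Matrix.dotProduct_mulVec, ← Matrix.mulVec_transpose, hEt]
  have hVs : ∀ x : Fin 3 → ℝ, V.mulVec x ⬝ᵥ n = - (x ⬝ᵥ v) := by
    intro x
    rw [hvv, Matrix.dotProduct_mulVec, ← Matrix.mulVec_transpose, hVt, Matrix.neg_mulVec,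
      neg_dotProduct, neg_neg]
  have hBt : Bᵀ = E - V := by
    rw [hE, hV]; module
  have hvn : v ⬝ᵥ n = 0 := by
    have := hVs n
    rw [dotProduct_comm n v] at this
    change v ⬝ᵥ n = _ at this
    linarith
  rw [hBt]
  simp only [T, Matrix.mul_add, Matrix.mul_smul, Matrix.trace_add, Matrix.trace_smul, hmv,
    Matrix.sub_mulVec, sub_dotProduct, hEs, hVs, smul_eq_mul, Matrix.sub_mul, Matrix.trace_sub,
    htr, htr0]
  rw [← hee, ← hvv, dotProduct_comm n e, dotProduct_comm n v, hvn, dotProduct_comm v d,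
    dotProduct_comm e m, dotProduct_comm v m, dotProduct_comm e d, hγ1, hγ2]
  rw [← hdd]
  linear_combination (m ⬝ᵥ e) * hParodi
end

section
/- (Nonnegativity of the total dissipation including ionic drag.) Let n ∈ ℝ³ with |n| = 1, D a symmetric traceless 3×3 real matrix, m ∈ ℝ³ with m·n = 0, and suppose α₄ > 0, α₁ + (3/2)α₄ + α₅ + α₆ > 0, γ₁ > 0, γ₁(2α₄ + α₅ + α₆) ≥ γ₂². Let N ≥ 1, and for k = 1,…,N let c_k ≥ 0 be real numbers, 𝒟_k symmetric positive-definite 3×3 real matrices, and w_k ∈ ℝ³ (the relative ion velocities u_k − v). Then, for any k_B θ > 0, R := (1/2)[α₁ (Dn·n)² + 2γ₂ (m·Dn) + α₄|D|_F² + (α₅+α₆)|Dn|² + γ₁|m|²] + Σ_{k=1}^{N} k_B θ c_k ⟨𝒟_k^{−1} w_k, w_k⟩ ≥ 0. -/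
open Matrix

lemma aux_key (a x y z p q r A B C d e f t : ℝ)
    (hn : x * x + y * y + z * z = 1)
    (hp : p = A * x + d * y + e * z) (hq : q = d * x + B * y + f * z)
    (hr : r = e * x + f * y + C * z) (ha : a = p * x + q * y + r * z)
    (ht : A + B + C = 0) (hT : t = A^2 + B^2 + C^2 + 2 * (d^2 + e^2 + f^2)) :
    2 * (p * p + q * q + r * r) - a^2 / 2 ≤ t := by
  have h : t - (2 * (p * p + q * q + r * r) - a^2 / 2) =
      (A - 2 * p * x + a / 2 * x * x + a / 2)^2 + (B - 2 * q * y + a / 2 * y * y + a / 2)^2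
      + (C - 2 * r * z + a / 2 * z * z + a / 2)^2
      + 2 * ((d - p * y - q * x + a / 2 * x * y)^2 + (e - p * z - r * x + a / 2 * x * z)^2
      + (f - q * z - r * y + a / 2 * y * z)^2) := by
    have e1 : A * x * x + B * y * y + C * z * z + 2 * (d * x * y + e * x * z + f * y * z) = a := by
      rw [ha, hp, hq, hr]; ring
    have e2 : p * (A * x + d * y + e * z) + q * (d * x + B * y + f * z)
        + r * (e * x + f * y + C * z) = p * p + q * q + r * r := by
      rw [← hp, ← hq, ← hr]
    have e3 : p * x + q * y + r * z = a := ha.symm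
    linear_combination hT - a * ht - a * e1 + 4 * e2
      - (2 * (p * p + q * q + r * r) + a^2 * (x * x + y * y + z * z + 1) / 4 + a^2 / 2
        - 2 * a * (p * x + q * y + r * z)) * hn
      - (2 * (p * x + q * y + r * z + a) - 4 * a) * e3
  have : 0 ≤ t - (2 * (p * p + q * q + r * r) - a^2 / 2) := by rw [h]; positivity
  linarith

/-- Nonnegativity of the total dissipation, including the ionic drag terms:
under Ericksen's conditions the Leslie–Ericksen dissipation plus the drag
dissipation of `N` ionic species is nonnegative. -/
theorem total_dissipation_nonneg
    (α1 α4 α5 α6 γ1 γ2 : ℝ)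
    (n : Fin 3 → ℝ) (hn : n ⬝ᵥ n = 1)
    (D : Matrix (Fin 3) (Fin 3) ℝ) (hD : D.IsSymm) (htr : D.trace = 0)
    (m : Fin 3 → ℝ) (hmn : m ⬝ᵥ n = 0)
    (h1 : 0 < α4)
    (h2 : 0 < α1 + (3/2) * α4 + α5 + α6)
    (h3 : 0 < γ1)
    (h4 : γ2^2 ≤ γ1 * (2 * α4 + α5 + α6))
    (N : ℕ) (hN : 1 ≤ N)
    (c : Fin N → ℝ) (hc : ∀ k, 0 ≤ c k)
    (𝒟 : Fin N → Matrix (Fin 3) (Fin 3) ℝ) (h𝒟 : ∀ k, (𝒟 k).PosDef)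
    (w : Fin N → Fin 3 → ℝ)
    (kBθ : ℝ) (hkBθ : 0 < kBθ) :
    0 ≤ (1/2) * (α1 * (D.mulVec n ⬝ᵥ n)^2 + 2 * γ2 * (m ⬝ᵥ D.mulVec n)
        + α4 * (Dᵀ * D).trace + (α5 + α6) * (D.mulVec n ⬝ᵥ D.mulVec n)
        + γ1 * (m ⬝ᵥ m))
      + ∑ k : Fin N, kBθ * c k * ((𝒟 k)⁻¹.mulVec (w k) ⬝ᵥ w k) := by
  have hdrag : 0 ≤ ∑ k : Fin N, kBθ * c k * ((𝒟 k)⁻¹.mulVec (w k) ⬝ᵥ w k) := by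
    refine Finset.sum_nonneg fun k _ => mul_nonneg (mul_nonneg hkBθ.le (hc k)) ?_
    have := (h𝒟 k).inv.posSemidef.dotProduct_mulVec_nonneg (w k)
    rw [dotProduct_comm]
    simpa using this
  refine add_nonneg (mul_nonneg (by norm_num) ?_) hdrag
  have key : 2 * (D.mulVec n ⬝ᵥ D.mulVec n) - (D.mulVec n ⬝ᵥ n)^2 / 2 ≤ (Dᵀ * D).trace := by
    have s1 := hD.apply 0 1
    have s2 := hD.apply 0 2
    have s3 := hD.apply 1 2
    simp only [dotProduct, Fin.sum_univ_three, Matrix.trace, Matrix.diag] at hn htr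
    have := aux_key (D.mulVec n ⬝ᵥ n) (n 0) (n 1) (n 2) (D.mulVec n 0) (D.mulVec n 1)
      (D.mulVec n 2) (D 0 0) (D 1 1) (D 2 2) (D 0 1) (D 0 2) (D 1 2) (Dᵀ * D).trace hn
      (by simp [mulVec, dotProduct, Fin.sum_univ_three])
      (by simp [mulVec, dotProduct, Fin.sum_univ_three, s1])
      (by simp [mulVec, dotProduct, Fin.sum_univ_three, s2, s3])
      (by simp [dotProduct, Fin.sum_univ_three]) htr
      (by simp [Matrix.trace, Matrix.mul_apply, Fin.sum_univ_three, s1, s2, s3]; ring)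
    simpa [dotProduct, Fin.sum_univ_three] using this
  generalize (Dᵀ * D).trace = t at key ⊢
  generalize D.mulVec n = v at key ⊢
  obtain ⟨a, ha⟩ : ∃ a, a = v ⬝ᵥ n := ⟨_, rfl⟩
  rw [← ha] at key ⊢
  simp only [dotProduct, Fin.sum_univ_three] at *
  have hq : 0 ≤ γ1 * ((2 * α4 + α5 + α6) * (v 0 * v 0 + v 1 * v 1 + v 2 * v 2 - a^2)
      + 2 * γ2 * (m 0 * v 0 + m 1 * v 1 + m 2 * v 2)
      + γ1 * (m 0 * m 0 + m 1 * m 1 + m 2 * m 2)) := by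
    have hP : v 0 * v 0 + v 1 * v 1 + v 2 * v 2 - a^2
        = (v 0 - a * n 0)^2 + (v 1 - a * n 1)^2 + (v 2 - a * n 2)^2 := by
      linear_combination (-2 * a) * ha - a^2 * hn
    have h5 := mul_nonneg (sub_nonneg.2 h4) (show 0 ≤ (v 0 - a * n 0)^2 + (v 1 - a * n 1)^2
      + (v 2 - a * n 2)^2 by positivity)
    have h6 : 0 ≤ (γ1 * m 0 + γ2 * (v 0 - a * n 0))^2 + (γ1 * m 1 + γ2 * (v 1 - a * n 1))^2
      + (γ1 * m 2 + γ2 * (v 2 - a * n 2))^2 := by positivity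
    rw [hP]
    linear_combination h5 + h6 - (2 * γ1 * γ2 * a) * hmn
  have hq' := nonneg_of_mul_nonneg_right hq h3
  have h7 := mul_le_mul_of_nonneg_left key h1.le
  have h8 := mul_nonneg h2.le (sq_nonneg a)
  linarith
end
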